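/- Under the stated setup, let S_u be a solo D-pair such that u and ū have no common neighbor in V∖S and all four edges between S_u and V∖S have f-weight 1/3. Then G is isomorphic to the Petersen graph. -/

import Mathlib

open Finset

/-- `m` encodes a perfect matching of the induced subgraph `G[S]`:
every vertex of `S` is matched to a distinct adjacent vertex of `S`. -/
def IsMatchingOn {V : Type*} (G : SimpleGraph V) (S : Finset V) (m : V → V) : Prop :=
  ∀ u ∈ S, m u ∈ S ∧ m u ≠ u ∧ G.Adj u (m u) ∧ m (m u) = u

/-- `S` is a paired dominating set of `G`: a dominating set such that `G[S]`
has a perfect matching. -/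
def IsPDS {V : Type*} (G : SimpleGraph V) (S : Finset V) : Prop :=
  (∀ v : V, v ∉ S → ∃ u ∈ S, G.Adj v u) ∧ ∃ m : V → V, IsMatchingOn G S m

/-- The paired domination number of `G`. -/
noncomputable def gammaPr {V : Type*} (G : SimpleGraph V) : ℕ :=
  sInf {k : ℕ | ∃ S : Finset V, IsPDS G S ∧ S.card = k}

/-- `N_S(x)`, the set of neighbours of `x` inside `S`. -/
def nbrS {V : Type*} [DecidableEq V] (G : SimpleGraph V) [DecidableRel G.Adj]
    (S : Finset V) (x : V) : Finset V :=
  S.filter (fun u => G.Adj x u)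

/-- `λ(S)`: (twice) the number of edges of `G[S]` (each edge counted in both directions). -/
def lambdaS {V : Type*} [DecidableEq V] (G : SimpleGraph V) [DecidableRel G.Adj]
    (S : Finset V) : ℕ :=
  ((S ×ˢ S).filter (fun p => G.Adj p.1 p.2)).card

/-- The private neighbours of `u ∈ S`: vertices outside `S` whose unique
neighbour in `S` is `u`. -/
def privates {V : Type*} [Fintype V] [DecidableEq V] (G : SimpleGraph V) [DecidableRel G.Adj]
    (S : Finset V) (u : V) : Finset V :=
  Finset.univ.filter (fun x => x ∉ S ∧ nbrS G S x = {u})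

/-- `A = {v ∈ S : v and v̄ together have at least two private neighbours}`. -/
def setA {V : Type*} [Fintype V] [DecidableEq V] (G : SimpleGraph V) [DecidableRel G.Adj]
    (S : Finset V) (m : V → V) : Finset V :=
  S.filter (fun v => 2 ≤ (privates G S v).card + (privates G S (m v)).card)

/-- `B = {v ∈ S : v has a private neighbour and v̄ has none}`. -/
def setB {V : Type*} [Fintype V] [DecidableEq V] (G : SimpleGraph V) [DecidableRel G.Adj]
    (S : Finset V) (m : V → V) : Finset V :=
  S.filter (fun v => (privates G S v).Nonempty ∧ privates G S (m v) = ∅)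

/-- `C = {v ∈ S : v̄ ∈ B}`. -/
def setC {V : Type*} [Fintype V] [DecidableEq V] (G : SimpleGraph V) [DecidableRel G.Adj]
    (S : Finset V) (m : V → V) : Finset V :=
  S.filter (fun v => m v ∈ setB G S m)

/-- `D = {v ∈ S : neither v nor v̄ has a private neighbour}`. -/
def setD {V : Type*} [Fintype V] [DecidableEq V] (G : SimpleGraph V) [DecidableRel G.Adj]
    (S : Finset V) (m : V → V) : Finset V :=
  S.filter (fun v => privates G S v = ∅ ∧ privates G S (m v) = ∅)

/-- The weight `f(xu)` of an edge `xu` with `x ∈ V∖S` and `u ∈ S`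
(`0` on non-edges and on pairs not of this form). -/
def fwt {V : Type*} [Fintype V] [DecidableEq V] (G : SimpleGraph V) [DecidableRel G.Adj]
    (S : Finset V) (m : V → V) (x u : V) : ℚ :=
  if x ∈ S ∨ u ∉ S ∨ ¬ G.Adj x u then 0
  else if nbrS G S x = {u} then 1
  else if nbrS G S x ⊆ setA G S m ∨ nbrS G S x ⊆ setB G S m ∪ setC G S m ∨
      nbrS G S x ⊆ setD G S m then
    1 / ((nbrS G S x).card : ℚ)
  else if u ∈ setA G S m then 0
  else if nbrS G S x ∩ setD G S m = ∅ then
    1 / (((nbrS G S x ∩ (setB G S m ∪ setC G S m))).card : ℚ)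
  else if u ∈ setB G S m ∪ setC G S m then 1 / 6
  else (1 - ((nbrS G S x ∩ (setB G S m ∪ setC G S m)).card : ℚ) / 6) /
      ((nbrS G S x ∩ setD G S m).card : ℚ)

/-- `f(S')`: total weight of the edges between `S' ⊆ S` and `V∖S`. -/
def fsum {V : Type*} [Fintype V] [DecidableEq V] (G : SimpleGraph V) [DecidableRel G.Adj]
    (S : Finset V) (m : V → V) (T : Finset V) : ℚ :=
  ∑ u ∈ T, ∑ x ∈ Finset.univ \ S, fwt G S m x u

/-- `C` is (the vertex set of) a connected component of `G[S]`. -/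
def IsComponent {V : Type*} [DecidableEq V] (G : SimpleGraph V) [DecidableRel G.Adj]
    (S C : Finset V) : Prop :=
  C ⊆ S ∧ C.Nonempty ∧ (G.induce (↑C : Set V)).Connected ∧
    ∀ u ∈ C, ∀ v ∈ S, G.Adj u v → v ∈ C

/-- `S_u = {u, m u}` is a `D`-pair. -/
def IsDPair {V : Type*} [Fintype V] [DecidableEq V] (G : SimpleGraph V) [DecidableRel G.Adj]
    (S : Finset V) (m : V → V) (u : V) : Prop :=
  u ∈ setD G S m ∧ m u ∈ setD G S m

/-- `S_u = {u, m u}` is an `A`-pair. -/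
def IsAPair {V : Type*} [Fintype V] [DecidableEq V] (G : SimpleGraph V) [DecidableRel G.Adj]
    (S : Finset V) (m : V → V) (u : V) : Prop :=
  u ∈ setA G S m ∧ m u ∈ setA G S m

/-- `S_u = {u, m u}` is a `BC`-pair. -/
def IsBCPair {V : Type*} [Fintype V] [DecidableEq V] (G : SimpleGraph V) [DecidableRel G.Adj]
    (S : Finset V) (m : V → V) (u : V) : Prop :=
  (u ∈ setB G S m ∧ m u ∈ setC G S m) ∨ (u ∈ setC G S m ∧ m u ∈ setB G S m)

/-- `u` is a leaf of `G[S]`: it has exactly one neighbour in `S`. -/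
def IsLeaf {V : Type*} [DecidableEq V] (G : SimpleGraph V) [DecidableRel G.Adj]
    (S : Finset V) (u : V) : Prop :=
  (nbrS G S u).card = 1

/-- `S_u` is a solo pair: both `u` and `m u` are leaves of `G[S]`. -/
def IsSoloPair {V : Type*} [DecidableEq V] (G : SimpleGraph V) [DecidableRel G.Adj]
    (S : Finset V) (m : V → V) (u : V) : Prop :=
  IsLeaf G S u ∧ IsLeaf G S (m u)

/-- The component `C` of `G[S]` contains no linked `D`-pairs: no edge of `G[S]`
joins vertices of two distinct `D`-pairs. -/
def NoLinkedDPairs {V : Type*} [Fintype V] [DecidableEq V] (G : SimpleGraph V)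
    [DecidableRel G.Adj] (S : Finset V) (m : V → V) (C : Finset V) : Prop :=
  ∀ u ∈ C, ∀ v ∈ C, u ∈ setD G S m → v ∈ setD G S m → v ≠ u → v ≠ m u → ¬ G.Adj u v

/-- `{w₁, w₂}` is a constraint pair of the solo `D`-pair `S_u`. -/
def ConstraintPair {V : Type*} [Fintype V] [DecidableEq V] (G : SimpleGraph V)
    [DecidableRel G.Adj] (S : Finset V) (m : V → V) (u w₁ w₂ : V) : Prop :=
  ∃ x y : V, x ∉ S ∧ y ∉ S ∧ G.Adj u y ∧ G.Adj (m u) x ∧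
    G.Adj x w₁ ∧ G.Adj y w₂ ∧ w₁ ∈ setD G S m ∧ w₂ ∈ setD G S m ∧
    w₁ ≠ w₂ ∧ m w₁ ≠ w₂

/-- The pairs `S_u` and `S_v` are adjacent: some vertex of one is adjacent
to some vertex of the other. -/
def PairAdj {V : Type*} (G : SimpleGraph V) (m : V → V) (u v : V) : Prop :=
  G.Adj u v ∨ G.Adj u (m v) ∨ G.Adj (m u) v ∨ G.Adj (m u) (m v)

/-- The Petersen graph, as the Kneser graph on 2-element subsets of a
5-element set, two subsets being adjacent iff they are disjoint. -/
def petersenGraph : SimpleGraph {s : Finset (Fin 5) // s.card = 2} where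
  Adj a b := Disjoint (a : Finset (Fin 5)) (b : Finset (Fin 5))
  symm := ⟨fun _ _ h => h.symm⟩
  loopless := by
    constructor
    intro a h
    rw [disjoint_self] at h
    have h2 := a.2
    rw [h] at h2
    simp at h2


def HasM {V : Type*} (G : SimpleGraph V) (Q : Finset V) : Prop := ∃ m, IsMatchingOn G Q m

theorem HasM.pair {V : Type*} [DecidableEq V] {G : SimpleGraph V} {p q : V} (h : G.Adj p q) :
    HasM G {p, q} := by
  have hne := h.ne
  refine ⟨fun t => if t = p then q else p, ?_⟩
  intro t ht
  simp only [Finset.mem_insert, Finset.mem_singleton] at ht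
  have := h.symm
  rcases ht with rfl | rfl
  · simp [hne.symm, h]
  · simp [hne, hne.symm, this]

theorem HasM.union {V : Type*} [DecidableEq V] {G : SimpleGraph V} {P Q : Finset V}
    (hP : HasM G P) (hQ : HasM G Q) (hd : ∀ t ∈ P, t ∉ Q) : HasM G (P ∪ Q) := by
  obtain ⟨f, hf⟩ := hP
  obtain ⟨g, hg⟩ := hQ
  refine ⟨fun t => if t ∈ P then f t else g t, ?_⟩
  intro t ht
  by_cases h : t ∈ P
  · have := hf t h
    simp [h, this]
  · have hq : t ∈ Q := by simpa [h] using ht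
    have := hg t hq
    have h2 : g t ∉ P := fun h3 => hd _ h3 this.1
    simp [h, this, h2]

/-- Basic data: matching, domination, minimality, maximum degree at most three, `D` part. -/
structure Base {V : Type*} [DecidableEq V] (G : SimpleGraph V)
    (S : Finset V) (m : V → V) (D : V → Prop) : Prop where
  mt : IsMatchingOn G S m
  dom : ∀ v : V, v ∉ S → ∃ u ∈ S, G.Adj v u
  mn : ∀ T : Finset V, IsPDS G T → S.card ≤ T.card
  deg : ∀ t p q r s, G.Adj t p → G.Adj t q → G.Adj t r → G.Adj t s →
    p = q ∨ p = r ∨ p = s ∨ q = r ∨ q = s ∨ r = s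
  DS : ∀ t, D t → t ∈ S
  Dm : ∀ t, D t → D (m t)
  np : ∀ t z, D t → z ∉ S → G.Adj z t → ∃ t' ∈ S, t' ≠ t ∧ G.Adj z t'

theorem Base.kill {V : Type*} [DecidableEq V] {G : SimpleGraph V}
    {S : Finset V} {m : V → V} {D : V → Prop} (h : Base G S m D) (R Q : Finset V)
    (hRS : R ⊆ S) (hR : ∀ t ∈ R, m t ∈ R) (hQ : HasM G Q) (hd : ∀ t ∈ Q, t ∈ S → t ∈ R)
    (hc : Q.card < R.card)
    (hdom : ∀ v, (v ∈ S → v ∈ R) → v ∉ Q → ∃ t, ((t ∈ S ∧ t ∉ R) ∨ t ∈ Q) ∧ G.Adj v t) :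
    False := by
  have h1 : HasM G (S \ R) := by
    refine ⟨m, ?_⟩
    intro t ht
    have ht' := Finset.mem_sdiff.1 ht
    have := h.mt t ht'.1
    refine ⟨Finset.mem_sdiff.2 ⟨this.1, fun h3 => ht'.2 ?_⟩, this.2⟩
    have := hR _ h3
    rwa [(h.mt t ht'.1).2.2.2] at this
  have h2 : HasM G (S \ R ∪ Q) := h1.union hQ (by
    intro t ht hq
    have ht' := Finset.mem_sdiff.1 ht
    exact ht'.2 (hd t hq ht'.1))
  have h3 := h.mn (S \ R ∪ Q) ⟨by
    intro v hv
    simp only [Finset.mem_union, Finset.mem_sdiff, not_or, not_and, not_not] at hv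
    obtain ⟨t, ht, ha⟩ := hdom v hv.1 hv.2
    exact ⟨t, by simpa using ht, ha⟩, h2⟩
  have h4 := Finset.card_union_le (S \ R) Q
  have h5 := Finset.card_sdiff_add_card_eq_card hRS
  omega

theorem card_pairs2_le {V : Type*} [DecidableEq V] (a b c d : V) :
    (({a, b} : Finset V) ∪ {c, d}).card ≤ 4 := by
  have := Finset.card_union_le ({a, b} : Finset V) {c, d}
  have := Finset.card_le_two (a := a) (b := b)
  have := Finset.card_le_two (a := c) (b := d)
  omega

theorem card_pairs2 {V : Type*} [DecidableEq V] {a b c d : V} (h1 : a ≠ b) (h2 : c ≠ d)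
    (h3 : a ≠ c ∧ a ≠ d ∧ b ≠ c ∧ b ≠ d) : (({a, b} : Finset V) ∪ {c, d}).card = 4 := by
  rw [Finset.card_union_of_disjoint, Finset.card_pair h1, Finset.card_pair h2]
  rw [Finset.disjoint_left]; intro t; grind

theorem card_pairs3 {V : Type*} [DecidableEq V] {a b c d e f : V} (h1 : a ≠ b) (h2 : c ≠ d)
    (h3 : e ≠ f) (h4 : a ≠ c ∧ a ≠ d ∧ b ≠ c ∧ b ≠ d) (h5 : a ≠ e ∧ a ≠ f ∧ b ≠ e ∧ b ≠ f)
    (h6 : c ≠ e ∧ c ≠ f ∧ d ≠ e ∧ d ≠ f) :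
    (({a, b} : Finset V) ∪ ({c, d} ∪ {e, f})).card = 6 := by
  rw [Finset.card_union_of_disjoint, Finset.card_pair h1, card_pairs2 h2 h3 h6]
  rw [Finset.disjoint_left]; intro t; grind

structure Cfg {V : Type*} [DecidableEq V] (G : SimpleGraph V)
    (S : Finset V) (m : V → V) (D : V → Prop)
    (u v x1 x2 y1 y2 a1 a2 b1 b2 c1 c2 d1 d2 : V) : Prop where
  base : Base G S m D
  Du : D u
  Dv : D v
  muv : m u = v
  mvu : m v = u
  huv : u ≠ v
  x1S : x1 ∉ S
  x2S : x2 ∉ S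
  y1S : y1 ∉ S
  y2S : y2 ∉ S
  hx : x1 ≠ x2
  hy : y1 ≠ y2
  h11 : x1 ≠ y1
  h12 : x1 ≠ y2
  h21 : x2 ≠ y1
  h22 : x2 ≠ y2
  nu : ∀ t, G.Adj u t ↔ t = v ∨ t = x1 ∨ t = x2
  nv : ∀ t, G.Adj v t ↔ t = u ∨ t = y1 ∨ t = y2
  nx1 : ∀ t, G.Adj x1 t ↔ t = u ∨ t = a1 ∨ t = a2
  nx2 : ∀ t, G.Adj x2 t ↔ t = u ∨ t = b1 ∨ t = b2
  ny1 : ∀ t, G.Adj y1 t ↔ t = v ∨ t = c1 ∨ t = c2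
  ny2 : ∀ t, G.Adj y2 t ↔ t = v ∨ t = d1 ∨ t = d2
  ha : a1 ≠ a2
  hb : b1 ≠ b2
  hc : c1 ≠ c2
  hd : d1 ≠ d2
  nn : ∀ w, (w = a1 ∨ w = a2 ∨ w = b1 ∨ w = b2 ∨ w = c1 ∨ w = c2 ∨ w = d1 ∨ w = d2) →
    D w ∧ w ≠ u ∧ w ≠ v

section
variable {V : Type*} [DecidableEq V] {G : SimpleGraph V}
    {S : Finset V} {m : V → V} {D : V → Prop}
    {u v x1 x2 y1 y2 a1 a2 b1 b2 c1 c2 d1 d2 : V}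

theorem Cfg.swapA (h : Cfg G S m D u v x1 x2 y1 y2 a1 a2 b1 b2 c1 c2 d1 d2) :
    Cfg G S m D u v x1 x2 y1 y2 a2 a1 b1 b2 c1 c2 d1 d2 := by
  obtain ⟨⟩ := h
  constructor <;> grind

theorem Cfg.swapB (h : Cfg G S m D u v x1 x2 y1 y2 a1 a2 b1 b2 c1 c2 d1 d2) :
    Cfg G S m D u v x1 x2 y1 y2 a1 a2 b2 b1 c1 c2 d1 d2 := by
  obtain ⟨⟩ := h
  constructor <;> grind

theorem Cfg.swapX (h : Cfg G S m D u v x1 x2 y1 y2 a1 a2 b1 b2 c1 c2 d1 d2) :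
    Cfg G S m D u v x2 x1 y1 y2 b1 b2 a1 a2 c1 c2 d1 d2 := by
  obtain ⟨⟩ := h
  constructor <;> grind

theorem Cfg.swapU (h : Cfg G S m D u v x1 x2 y1 y2 a1 a2 b1 b2 c1 c2 d1 d2) :
    Cfg G S m D v u y1 y2 x1 x2 c1 c2 d1 d2 a1 a2 b1 b2 := by
  obtain ⟨⟩ := h
  constructor <;> grind

theorem Cfg.swapC (h : Cfg G S m D u v x1 x2 y1 y2 a1 a2 b1 b2 c1 c2 d1 d2) :
    Cfg G S m D u v x1 x2 y1 y2 a1 a2 b1 b2 c2 c1 d1 d2 := h.swapU.swapA.swapU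

theorem Cfg.swapD (h : Cfg G S m D u v x1 x2 y1 y2 a1 a2 b1 b2 c1 c2 d1 d2) :
    Cfg G S m D u v x1 x2 y1 y2 a1 a2 b1 b2 c1 c2 d2 d1 := h.swapU.swapB.swapU

theorem Cfg.swapY (h : Cfg G S m D u v x1 x2 y1 y2 a1 a2 b1 b2 c1 c2 d1 d2) :
    Cfg G S m D u v x1 x2 y2 y1 a1 a2 b1 b2 d1 d2 c1 c2 := h.swapU.swapX.swapU

/-- The main exchange, for `a1` and `c1`. -/
theorem Cfg.K0 (h : Cfg G S m D u v x1 x2 y1 y2 a1 a2 b1 b2 c1 c2 d1 d2)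
    (h1 : a1 ≠ c1) (h2 : m a1 ≠ c1) :
    ∃ z, z ∉ S ∧ G.Adj z (m a1) ∧ G.Adj z (m c1) ∧
      ∀ t ∈ S, G.Adj z t → t = u ∨ t = v ∨ t = m a1 ∨ t = m c1 := by
  obtain ⟨Da, au, av⟩ := h.nn a1 (by simp)
  obtain ⟨Dc, cu, cv⟩ := h.nn c1 (by simp)
  have aS := h.base.DS _ Da
  have cS := h.base.DS _ Dc
  have uS := h.base.DS _ h.Du
  have vS := h.base.DS _ h.Dv
  obtain ⟨maS, maa, aa, mma⟩ := h.base.mt _ aS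
  obtain ⟨mcS, mcc, ac, mmc⟩ := h.base.mt _ cS
  have Dma := h.base.Dm _ Da
  have Dmc := h.base.Dm _ Dc
  have muv := h.muv
  have mvu := h.mvu
  have huv := h.huv
  have e1 : m a1 ≠ u := by grind
  have e2 : m a1 ≠ v := by grind
  have e3 : m c1 ≠ u := by grind
  have e4 : m c1 ≠ v := by grind
  have e5 : m a1 ≠ m c1 := by grind
  have e6 : a1 ≠ m c1 := by grind
  have x1S := h.x1S
  have y1S := h.y1S
  have h11 := h.h11
  have axa : G.Adj x1 a1 := (h.nx1 _).2 (by simp)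
  have ayc : G.Adj y1 c1 := (h.ny1 _).2 (by simp)
  by_contra hcon
  push Not at hcon
  refine h.base.kill ({u, v} ∪ ({a1, m a1} ∪ {c1, m c1})) ({x1, a1} ∪ {y1, c1}) ?_ ?_ ?_ ?_ ?_ ?_
  · intro t; grind
  · intro t; grind
  · refine (HasM.pair axa).union (HasM.pair ayc) ?_
    intro t; grind
  · intro t; grind
  · rw [card_pairs3 huv maa.symm mcc.symm (by grind) (by grind) (by grind)]
    have := card_pairs2_le x1 a1 y1 c1
    omega
  · intro t ht htQ
    by_cases htS : t ∈ S
    · have : t = u ∨ t = v ∨ t = m a1 ∨ t = m c1 := by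
        have := ht htS
        grind
      rcases this with rfl | rfl | rfl | rfl
      · exact ⟨x1, by simp, (h.nu _).2 (by simp)⟩
      · exact ⟨y1, by simp, (h.nv _).2 (by simp)⟩
      · exact ⟨a1, by simp, aa.symm⟩
      · exact ⟨c1, by simp, ac.symm⟩
    · by_contra hno
      push Not at hno
      have sub : ∀ s ∈ S, G.Adj t s → s = u ∨ s = v ∨ s = m a1 ∨ s = m c1 := by
        intro s hs hts
        have := hno s
        grind
      have nn := h.nn
      have hA : ∀ s ∈ S, s = u ∨ s = v → G.Adj t s → G.Adj t (m a1) ∧ G.Adj t (m c1) := by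
        intro s hs hs2 hts
        have hts' := hts.symm
        have : t = x1 ∨ t = x2 ∨ t = y1 ∨ t = y2 := by
          rcases hs2 with rfl | rfl
          · have := (h.nu t).1 hts'; grind
          · have := (h.nv t).1 hts'; grind
        have DS := h.base.DS
        rcases this with rfl | rfl | rfl | rfl
        · grind
        · have i1 := sub b1 (DS _ (nn b1 (by simp)).1) ((h.nx2 _).2 (by simp))
          have i2 := sub b2 (DS _ (nn b2 (by simp)).1) ((h.nx2 _).2 (by simp))
          have := nn b1 (by simp)
          have := nn b2 (by simp)
          have := h.hb
          have := h.nx2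
          grind
        · grind
        · have i1 := sub d1 (DS _ (nn d1 (by simp)).1) ((h.ny2 _).2 (by simp))
          have i2 := sub d2 (DS _ (nn d2 (by simp)).1) ((h.ny2 _).2 (by simp))
          have := nn d1 (by simp)
          have := nn d2 (by simp)
          have := h.hd
          have := h.ny2
          grind
      have hB : G.Adj t (m a1) ∧ G.Adj t (m c1) := by
        obtain ⟨s, hs, hts⟩ := h.base.dom t htS
        by_cases hsu : s = u ∨ s = v
        · exact hA s hs hsu hts
        · have Ds : D s := by have := sub s hs hts; grind
          obtain ⟨s', hs', hne, hts'⟩ := h.base.np s t Ds htS hts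
          by_cases hsu' : s' = u ∨ s' = v
          · exact hA s' hs' hsu' hts'
          · have := sub s hs hts
            have := sub s' hs' hts'
            grind
      obtain ⟨r, hr, htr, hrr⟩ := hcon t htS hB.1 hB.2
      grind

theorem Cfg.K (h : Cfg G S m D u v x1 x2 y1 y2 a1 a2 b1 b2 c1 c2 d1 d2) {w w' : V}
    (hw : w = a1 ∨ w = a2 ∨ w = b1 ∨ w = b2) (hw' : w' = c1 ∨ w' = c2 ∨ w' = d1 ∨ w' = d2)
    (h1 : w ≠ w') (h2 : m w ≠ w') :
    ∃ z, z ∉ S ∧ G.Adj z (m w) ∧ G.Adj z (m w') ∧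
      ∀ t ∈ S, G.Adj z t → t = u ∨ t = v ∨ t = m w ∨ t = m w' := by
  have key : ∀ {x1 x2 a1 a2 b1 b2}, Cfg G S m D u v x1 x2 y1 y2 a1 a2 b1 b2 c1 c2 d1 d2 →
      w = a1 → ∃ z, z ∉ S ∧ G.Adj z (m w) ∧ G.Adj z (m w') ∧
      ∀ t ∈ S, G.Adj z t → t = u ∨ t = v ∨ t = m w ∨ t = m w' := by
    intro x1 x2 a1 a2 b1 b2 h e
    subst e
    rcases hw' with rfl | rfl | rfl | rfl
    · exact h.K0 h1 h2
    · exact h.swapC.K0 h1 h2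
    · exact h.swapY.K0 h1 h2
    · exact h.swapY.swapC.K0 h1 h2
  rcases hw with e | e | e | e
  · exact key h e
  · exact key h.swapA e
  · exact key h.swapX e
  · exact key h.swapX.swapA e

/-- No vertex of `X` can be unrelated to three distinct vertices of `Y`. -/
theorem Cfg.L3 (h : Cfg G S m D u v x1 x2 y1 y2 a1 a2 b1 b2 c1 c2 d1 d2) {w p q r : V}
    (hw : w = a1 ∨ w = a2 ∨ w = b1 ∨ w = b2)
    (hp : p = c1 ∨ p = c2 ∨ p = d1 ∨ p = d2)
    (hq : q = c1 ∨ q = c2 ∨ q = d1 ∨ q = d2)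
    (hr : r = c1 ∨ r = c2 ∨ r = d1 ∨ r = d2)
    (hpq : p ≠ q) (hpr : p ≠ r) (hqr : q ≠ r) :
    w = p ∨ w = q ∨ w = r ∨ m w = p ∨ m w = q ∨ m w = r := by
  by_contra hcon
  push Not at hcon
  obtain ⟨n1, n2, n3, n4, n5, n6⟩ := hcon
  obtain ⟨z1, z1S, i1, j1, k1⟩ := h.K hw hp n1 n4
  obtain ⟨z2, z2S, i2, j2, k2⟩ := h.K hw hq n2 n5
  obtain ⟨z3, z3S, i3, j3, k3⟩ := h.K hw hr n3 n6
  have wS := h.base.DS _ (h.nn w (by grind)).1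
  have hpn := h.nn p (by grind)
  have hqn := h.nn q (by grind)
  have hrn := h.nn r (by grind)
  have pS := h.base.DS _ hpn.1
  have qS := h.base.DS _ hqn.1
  have rS := h.base.DS _ hrn.1
  have Mw := h.base.mt _ wS
  have Mp := h.base.mt _ pS
  have Mq := h.base.mt _ qS
  have Mr := h.base.mt _ rS
  have muv := h.muv
  have mvu := h.mvu
  have dg := h.base.deg (m w) w z1 z2 z3 Mw.2.2.1.symm i1.symm i2.symm i3.symm
  have a1 := k1 _ Mq.1
  have a2 := k1 _ Mr.1
  have a3 := k2 _ Mr.1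
  grind

end

section
variable {V : Type*} [DecidableEq V] {G : SimpleGraph V}
    {S : Finset V} {m : V → V} {D : V → Prop}
    {u v x1 x2 y1 y2 a1 a2 b1 b2 c1 c2 d1 d2 : V}

/-- A neighbour outside `S` of a vertex of `S` with two known outside neighbours. -/
theorem Base.out (h : Base G S m D) {w p q z : V} (hw : w ∈ S) (hp : p ∉ S) (hq : q ∉ S)
    (hpq : p ≠ q) (h1 : G.Adj w p) (h2 : G.Adj w q) (h3 : G.Adj w z) :
    z = m w ∨ z = p ∨ z = q := by
  have M := h.mt w hw
  have := h.deg w (m w) p q z M.2.2.1 h1 h2 h3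
  have := M.1
  grind

/-- The ten-vertex configuration with `|X| = |Y| = 3`. -/
theorem Cfg.kill33 {c e f : V} (h : Cfg G S m D u v x1 x2 y1 y2 (m c) e (m c) f c e c f)
    (hef : m e = f) : False := by
  have nc := h.nn c (by simp)
  have ne := h.nn e (by simp)
  have nf := h.nn f (by simp)
  have nmc := h.nn (m c) (by simp)
  have cS := h.base.DS _ nc.1
  have eS := h.base.DS _ ne.1
  have fS := h.base.DS _ nf.1
  have uS := h.base.DS _ h.Du
  have vS := h.base.DS _ h.Dv
  have Mc := h.base.mt _ cS
  have Me := h.base.mt _ eS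
  have hc := h.hc
  have hd := h.hd
  have ha := h.ha
  have hb := h.hb
  have muv := h.muv
  have mvu := h.mvu
  have huv := h.huv
  have x1S := h.x1S
  have x2S := h.x2S
  have y1S := h.y1S
  have y2S := h.y2S
  have h21 := h.h21
  have ay : G.Adj y1 e := (h.ny1 _).2 (by simp)
  have ax : G.Adj x2 f := (h.nx2 _).2 (by simp)
  have A1 : G.Adj c y1 := ((h.ny1 _).2 (by simp)).symm
  have A2 : G.Adj c y2 := ((h.ny2 _).2 (by simp)).symm
  have A3 : G.Adj (m c) x1 := ((h.nx1 _).2 (by simp)).symm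
  have A4 : G.Adj (m c) x2 := ((h.nx2 _).2 (by simp)).symm
  refine h.base.kill ({u, v} ∪ ({c, m c} ∪ {e, f})) ({y1, e} ∪ {x2, f}) ?_ ?_ ?_ ?_ ?_ ?_
  · intro t; grind
  · intro t; grind
  · refine (HasM.pair ay).union (HasM.pair ax) ?_
    intro t; grind
  · intro t; grind
  · rw [card_pairs3 huv Mc.2.1.symm (by grind) (by grind) (by grind) (by grind)]
    have := card_pairs2_le y1 e x2 f
    omega
  · intro t ht htQ
    by_cases htS : t ∈ S
    · have : t = u ∨ t = v ∨ t = c ∨ t = m c := by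
        have := ht htS
        grind
      rcases this with rfl | rfl | rfl | rfl
      · exact ⟨x2, by simp, (h.nu _).2 (by simp)⟩
      · exact ⟨y1, by simp, (h.nv _).2 (by simp)⟩
      · exact ⟨y1, by simp, A1⟩
      · exact ⟨x2, by simp, A4⟩
    · obtain ⟨s, hs, hts⟩ := h.base.dom t htS
      by_cases hsT : (s ∈ S ∧ s ∉ (({u, v} : Finset V) ∪ ({c, m c} ∪ {e, f}))) ∨
          s ∈ (({y1, e} : Finset V) ∪ {x2, f})
      · exact ⟨s, hsT, hts⟩
      · have hs2 : s = u ∨ s = v ∨ s = c ∨ s = m c := by grind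
        have : t = x1 ∨ t = x2 ∨ t = y1 ∨ t = y2 := by
          rcases hs2 with rfl | rfl | rfl | rfl
          · have := (h.nu t).1 hts.symm; grind
          · have := (h.nv t).1 hts.symm; grind
          · have := h.base.out cS y1S y2S h.hy A1 A2 hts.symm; grind
          · have := h.base.out Mc.1 x1S x2S h.hx A3 A4 hts.symm; grind
        rcases this with rfl | rfl | rfl | rfl
        · exact ⟨e, by simp, (h.nx1 _).2 (by simp)⟩
        · exact ⟨f, by simp, ax⟩
        · exact ⟨e, by simp, ay⟩
        · exact ⟨f, by simp, (h.ny2 _).2 (by simp)⟩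

/-- `|Y| = 3` and the partner of the repeated vertex is in `X`. -/
theorem Cfg.Y3a {c e f : V} (h : Cfg G S m D u v x1 x2 y1 y2 a1 a2 b1 b2 c e c f)
    (hef : e ≠ f) (hac : a1 = m c) : False := by
  subst hac
  have nc := h.nn c (by simp)
  have ne := h.nn e (by simp)
  have nf := h.nn f (by simp)
  have nmc := h.nn (m c) (by simp)
  have cS := h.base.DS _ nc.1
  have eS := h.base.DS _ ne.1
  have fS := h.base.DS _ nf.1
  have Mc := h.base.mt _ cS
  have Me := h.base.mt _ eS
  have Mf := h.base.mt _ fS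
  have hc := h.hc
  have hd := h.hd
  have ha := h.ha
  have hb := h.hb
  have hx := h.hx
  have h11 := h.h11
  have h12 := h.h12
  have h21 := h.h21
  have h22 := h.h22
  have muv := h.muv
  have mvu := h.mvu
  have x1S := h.x1S
  have x2S := h.x2S
  have y1S := h.y1S
  have y2S := h.y2S
  have ny1 := h.ny1
  have ny2 := h.ny2
  have A1 : G.Adj c y1 := ((h.ny1 _).2 (by simp)).symm
  have A2 : G.Adj c y2 := ((h.ny2 _).2 (by simp)).symm
  have key : ∀ g, (g = e ∨ g = f) → m c ≠ g → m g = e ∨ m g = f := by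
    intro g hg hne
    have ng := h.nn g (by grind)
    have gS := h.base.DS _ ng.1
    have Mg := h.base.mt _ gS
    obtain ⟨z, zS, i, j, k⟩ := h.K (w := m c) (w' := g) (by simp) (by grind) hne (by grind)
    rw [Mc.2.2.2] at i
    have := h.base.out cS y1S y2S h.hy A1 A2 i.symm
    have : z = y1 ∨ z = y2 := by grind
    rcases this with rfl | rfl
    · have := (ny1 _).1 j; grind
    · have := (ny2 _).1 j; grind
  have k1 := key e (by simp)
  have k2 := key f (by simp)
  have hme : m e = f := by grind
  have cX : ∀ w, (w = m c ∨ w = a2 ∨ w = b1 ∨ w = b2) → w = m c ∨ w = e ∨ w = f := by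
    intro w hw
    have nw := h.nn w (by grind)
    have wS := h.base.DS _ nw.1
    have Mw := h.base.mt _ wS
    have := h.L3 (w := w) (p := c) (q := e) (r := f) (by grind) (by simp) (by simp) (by simp)
      hc hd hef
    have hwc : w ≠ c := by
      rintro rfl
      have hz : G.Adj w x1 ∨ G.Adj w x2 := by
        rcases hw with hw | hw | hw | hw
        · left; exact ((h.nx1 _).2 (by grind)).symm
        · left; exact ((h.nx1 _).2 (by grind)).symm
        · right; exact ((h.nx2 _).2 (by grind)).symm
        · right; exact ((h.nx2 _).2 (by grind)).symm
      rcases hz with hz | hz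
      · have := h.base.out cS y1S y2S h.hy A1 A2 hz; grind
      · have := h.base.out cS y1S y2S h.hy A1 A2 hz; grind
    grind
  have twice : ∀ w, (w = b1 ∨ w = b2) → a2 ≠ w := by
    rintro w hw rfl
    have wS := h.base.DS _ (h.nn a2 (by simp)).1
    have B1 : G.Adj a2 x1 := ((h.nx1 _).2 (by simp)).symm
    have B2 : G.Adj a2 x2 := ((h.nx2 _).2 (by grind)).symm
    have : a2 = e ∨ a2 = f := by have := cX a2 (by simp); grind
    rcases this with rfl | rfl
    · have B3 : G.Adj a2 y1 := ((h.ny1 _).2 (by simp)).symm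
      have := h.base.out wS x1S x2S hx B1 B2 B3; grind
    · have B3 : G.Adj a2 y2 := ((h.ny2 _).2 (by simp)).symm
      have := h.base.out wS x1S x2S hx B1 B2 B3; grind
  have t1 := twice b1 (by simp)
  have t2 := twice b2 (by simp)
  have r1 := cX a2 (by simp)
  have r2 := cX b1 (by simp)
  have r3 := cX b2 (by simp)
  have hmf : m f = e := by grind
  have : (a2 = e ∧ b1 = m c ∧ b2 = f) ∨ (a2 = e ∧ b2 = m c ∧ b1 = f) ∨
    (a2 = f ∧ b1 = m c ∧ b2 = e) ∨ (a2 = f ∧ b2 = m c ∧ b1 = e) := by grind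
  rcases this with ⟨rfl, rfl, rfl⟩ | ⟨rfl, rfl, rfl⟩ | ⟨rfl, rfl, rfl⟩ | ⟨rfl, rfl, rfl⟩
  · exact h.kill33 hme
  · exact h.swapB.kill33 hme
  · exact h.swapY.kill33 hmf
  · exact h.swapB.swapY.kill33 hmf

theorem Cfg.Y3b {c e f : V} (h : Cfg G S m D u v x1 x2 y1 y2 a1 a2 a1 a2 c e c f)
    (hef : e ≠ f) (h1 : a1 ≠ m c) (h2 : a2 ≠ m c) : False := by
  have nc := h.nn c (by simp)
  have ne := h.nn e (by simp)
  have nf := h.nn f (by simp)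
  have na := h.nn a1 (by simp)
  have nb := h.nn a2 (by simp)
  have cS := h.base.DS _ nc.1
  have eS := h.base.DS _ ne.1
  have fS := h.base.DS _ nf.1
  have aS := h.base.DS _ na.1
  have bS := h.base.DS _ nb.1
  have Mc := h.base.mt _ cS
  have Me := h.base.mt _ eS
  have Mf := h.base.mt _ fS
  have Ma := h.base.mt _ aS
  have Mb := h.base.mt _ bS
  have hc := h.hc
  have hd := h.hd
  have ha := h.ha
  have hx := h.hx
  have h11 := h.h11
  have h12 := h.h12
  have h21 := h.h21
  have h22 := h.h22
  have x1S := h.x1S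
  have x2S := h.x2S
  have y1S := h.y1S
  have y2S := h.y2S
  have B1 : G.Adj a1 x1 := ((h.nx1 _).2 (by simp)).symm
  have B2 : G.Adj a1 x2 := ((h.nx2 _).2 (by simp)).symm
  have B3 : G.Adj a2 x1 := ((h.nx1 _).2 (by simp)).symm
  have B4 : G.Adj a2 x2 := ((h.nx2 _).2 (by simp)).symm
  have notY : ∀ w g, (w = a1 ∨ w = a2) → (g = c ∨ g = e ∨ g = f) → w ≠ g := by
    rintro w g hw hg rfl
    have Y : G.Adj w y1 ∨ G.Adj w y2 := by
      rcases hg with hg | hg | hg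
      · left; exact ((h.ny1 _).2 (by grind)).symm
      · left; exact ((h.ny1 _).2 (by grind)).symm
      · right; exact ((h.ny2 _).2 (by grind)).symm
    have hwx : G.Adj w x1 ∧ G.Adj w x2 := by grind
    rcases Y with Y | Y
    · have := h.base.out (w := w) (by grind) x1S x2S hx hwx.1 hwx.2 Y; grind
    · have := h.base.out (w := w) (by grind) x1S x2S hx hwx.1 hwx.2 Y; grind
  have L1 := h.L3 (w := a1) (p := c) (q := e) (r := f) (by grind) (by simp) (by simp) (by simp)
      hc hd hef
  have L2 := h.L3 (w := a2) (p := c) (q := e) (r := f) (by grind) (by simp) (by simp) (by simp)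
      hc hd hef
  have p1 := notY a1
  have p2 := notY a2
  have nx1 := h.nx1
  have nx2 := h.nx2
  have fin : ∀ g g', (g = e ∨ g = f) → (g' = e ∨ g' = f) → m a1 = g → m a2 = g' → False := by
    intro g g' hg hg' e1 e2
    have hne : g ≠ g' := by grind
    obtain ⟨z, zS, i, j, k⟩ := h.K (w := a1) (w' := g') (by simp) (by grind) (by grind) (by grind)
    have hz : G.Adj a2 z := by
      have : m g' = a2 := by grind
      rw [this] at j
      exact j.symm
    have := h.base.out bS x1S x2S hx B3 B4 hz
    have : z = x1 ∨ z = x2 := by grind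
    have ng := h.nn g (by grind)
    rw [e1] at i
    rcases this with rfl | rfl
    · have := (nx1 _).1 i; grind
    · have := (nx2 _).1 i; grind
  grind

/-- `|Y| = 3` is impossible. -/
theorem Cfg.Y3 {c e f : V} (h : Cfg G S m D u v x1 x2 y1 y2 a1 a2 b1 b2 c e c f)
    (hef : e ≠ f) : False := by
  by_cases q1 : a1 = m c
  · exact h.Y3a hef q1
  by_cases q2 : a2 = m c
  · exact h.swapA.Y3a hef q2
  by_cases q3 : b1 = m c
  · exact h.swapX.Y3a hef q3
  by_cases q4 : b2 = m c
  · exact h.swapX.swapA.Y3a hef q4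
  have nc := h.nn c (by simp)
  have cS := h.base.DS _ nc.1
  have Mc := h.base.mt _ cS
  have A1 : G.Adj c y1 := ((h.ny1 _).2 (by simp)).symm
  have A2 : G.Adj c y2 := ((h.ny2 _).2 (by simp)).symm
  have h11 := h.h11
  have h12 := h.h12
  have h21 := h.h21
  have h22 := h.h22
  have x1S := h.x1S
  have x2S := h.x2S
  have y1S := h.y1S
  have y2S := h.y2S
  have ha := h.ha
  have hb := h.hb
  have X1 : ¬ G.Adj c x1 := by
    intro hz
    have := h.base.out cS y1S y2S h.hy A1 A2 hz; grind
  have X2 : ¬ G.Adj c x2 := by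
    intro hz
    have := h.base.out cS y1S y2S h.hy A1 A2 hz; grind
  rw [G.adj_comm, h.nx1] at X1
  rw [G.adj_comm, h.nx2] at X2
  have L1 := h.swapU.L3 (w := c) (p := a1) (q := a2) (r := b1) (by simp) (by simp) (by simp)
    (by simp)
  have L2 := h.swapU.L3 (w := c) (p := a1) (q := a2) (r := b2) (by simp) (by simp) (by simp)
    (by simp)
  have : (a1 = b1 ∧ a2 = b2) ∨ (a1 = b2 ∧ a2 = b1) := by grind
  rcases this with ⟨rfl, rfl⟩ | ⟨rfl, rfl⟩
  · exact h.Y3b hef q1 q2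
  · exact h.swapB.Y3b hef q1 q2

end

section
variable {V : Type*} [DecidableEq V] {G : SimpleGraph V}
    {S : Finset V} {m : V → V} {D : V → Prop}
    {u v x1 x2 y1 y2 a1 a2 b1 b2 c1 c2 d1 d2 : V}

theorem Cfg.sep {a b c d : V} (h : Cfg G S m D u v x1 x2 y1 y2 a b a b c d c d) :
    ∀ p q, (p = a ∨ p = b) → (q = c ∨ q = d) → p ≠ q := by
  rintro p q hp hq rfl
  have pS := h.base.DS _ (h.nn p (by grind)).1
  have B1 : G.Adj p x1 := ((h.nx1 _).2 (by grind)).symm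
  have B2 : G.Adj p x2 := ((h.nx2 _).2 (by grind)).symm
  have B3 : G.Adj p y1 := ((h.ny1 _).2 (by grind)).symm
  have := h.base.out pS h.x1S h.x2S h.hx B1 B2 B3
  have := h.base.mt _ pS
  have := h.y1S
  have := h.h11
  have := h.h21
  grind

theorem Cfg.mcd {a b c d : V} (h : Cfg G S m D u v x1 x2 y1 y2 a b a b c d c d) :
    m c ≠ d := by
  intro hcd
  have sp := h.sep
  have na := h.nn a (by simp)
  have nc := h.nn c (by simp)
  have nd := h.nn d (by simp)
  have aS := h.base.DS _ na.1
  have cS := h.base.DS _ nc.1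
  have dS := h.base.DS _ nd.1
  have Ma := h.base.mt _ aS
  have Mc := h.base.mt _ cS
  have Md := h.base.mt _ dS
  have muv := h.muv
  have mvu := h.mvu
  obtain ⟨z, zS, i, j, k⟩ := h.K (w := a) (w' := c) (by simp) (by simp) (by grind) (by grind)
  rw [hcd] at j
  have D1 : G.Adj d y1 := ((h.ny1 _).2 (by simp)).symm
  have D2 : G.Adj d y2 := ((h.ny2 _).2 (by simp)).symm
  have := h.base.out dS h.y1S h.y2S h.hy D1 D2 j.symm
  have : z = y1 ∨ z = y2 := by grind
  rcases this with rfl | rfl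
  · have := (h.ny1 _).1 i; grind
  · have := (h.ny2 _).1 i; grind

theorem Cfg.mac {a b c d : V} (h : Cfg G S m D u v x1 x2 y1 y2 a b a b c d c d) :
    m a ≠ c := by
  intro hac
  have sp := h.sep
  have mcd := h.mcd
  have na := h.nn a (by simp)
  have nc := h.nn c (by simp)
  have nd := h.nn d (by simp)
  have aS := h.base.DS _ na.1
  have cS := h.base.DS _ nc.1
  have dS := h.base.DS _ nd.1
  have Ma := h.base.mt _ aS
  have Mc := h.base.mt _ cS
  have Md := h.base.mt _ dS
  have muv := h.muv
  have mvu := h.mvu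
  have hc := h.hc
  obtain ⟨z, zS, i, j, k⟩ := h.K (w := a) (w' := d) (by simp) (by simp) (by grind) (by grind)
  rw [hac] at i
  have D1 : G.Adj c y1 := ((h.ny1 _).2 (by simp)).symm
  have D2 : G.Adj c y2 := ((h.ny2 _).2 (by simp)).symm
  have := h.base.out cS h.y1S h.y2S h.hy D1 D2 i.symm
  have : z = y1 ∨ z = y2 := by grind
  rcases this with rfl | rfl
  · have := (h.ny1 _).1 j; grind
  · have := (h.ny2 _).1 j; grind

theorem Cfg.kill22 {a b c d : V} (h : Cfg G S m D u v x1 x2 y1 y2 a b a b c d c d) : False := by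
  have sp := h.sep
  have mcd := h.mcd
  have mab := h.swapU.mcd
  have mac := h.mac
  have mad := h.swapC.swapD.mac
  have mbc := h.swapA.swapB.mac
  have mbd := h.swapA.swapB.swapC.swapD.mac
  have sac := sp a c (by simp) (by simp)
  have sad := sp a d (by simp) (by simp)
  have sbc := sp b c (by simp) (by simp)
  have sbd := sp b d (by simp) (by simp)
  clear sp
  have na := h.nn a (by simp)
  have nb := h.nn b (by simp)
  have nc := h.nn c (by simp)
  have nd := h.nn d (by simp)
  have aS := h.base.DS _ na.1
  have bS := h.base.DS _ nb.1
  have cS := h.base.DS _ nc.1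
  have dS := h.base.DS _ nd.1
  have uS := h.base.DS _ h.Du
  have vS := h.base.DS _ h.Dv
  obtain ⟨maS, maa, aa, mma⟩ := h.base.mt _ aS
  obtain ⟨mbS, mbb, ab, mmb⟩ := h.base.mt _ bS
  obtain ⟨mcS, mcc, ac, mmc⟩ := h.base.mt _ cS
  obtain ⟨mdS, mdd, ad, mmd⟩ := h.base.mt _ dS
  have muv := h.muv
  have mvu := h.mvu
  have hab := h.ha
  have hcd := h.hc
  obtain ⟨z1, z1S, i1, j1, k1⟩ := h.K (w := a) (w' := c) (by simp) (by simp) sac mac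
  obtain ⟨z2, z2S, i2, j2, k2⟩ := h.K (w := a) (w' := d) (by simp) (by simp) sad mad
  obtain ⟨z3, z3S, i3, j3, k3⟩ := h.K (w := b) (w' := c) (by simp) (by simp) sbc mbc
  obtain ⟨z4, z4S, i4, j4, k4⟩ := h.K (w := b) (w' := d) (by simp) (by simp) sbd mbd
  have n1 : m a ≠ m b := by grind
  have n2 : m c ≠ m d := by grind
  have n3 : m a ≠ m c := by grind
  have n4 : m a ≠ m d := by grind
  have n5 : m b ≠ m c := by grind
  have n6 : m b ≠ m d := by grind
  have mau : m a ≠ u ∧ m a ≠ v := by grind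
  have mbu : m b ≠ u ∧ m b ≠ v := by grind
  have mcu : m c ≠ u ∧ m c ≠ v := by grind
  have mdu : m d ≠ u ∧ m d ≠ v := by grind
  have d13 : z1 ≠ z3 := by
    rintro rfl
    have := k1 _ mbS i3; grind
  have d24 : z2 ≠ z4 := by
    rintro rfl
    have := k2 _ mbS i4; grind
  have d14 : z1 ≠ z4 := by
    rintro rfl
    have := k1 _ mbS i4; grind
  have X1 : G.Adj x1 a := (h.nx1 _).2 (by simp)
  have X2 : G.Adj x1 b := (h.nx1 _).2 (by simp)
  have X3 : G.Adj x2 a := (h.nx2 _).2 (by simp)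
  have X4 : G.Adj x2 b := (h.nx2 _).2 (by simp)
  have Y1 : G.Adj y1 c := (h.ny1 _).2 (by simp)
  have Y2 : G.Adj y1 d := (h.ny1 _).2 (by simp)
  have Y3 : G.Adj y2 c := (h.ny2 _).2 (by simp)
  have Y4 : G.Adj y2 d := (h.ny2 _).2 (by simp)
  have U1 : G.Adj u x1 := (h.nu _).2 (by simp)
  have U2 : G.Adj u x2 := (h.nu _).2 (by simp)
  have UV : G.Adj u v := (h.nu _).2 (by simp)
  have zx : z1 ≠ x1 ∧ z1 ≠ y1 ∧ z4 ≠ x1 ∧ z4 ≠ y1 := by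
    have c1 := h.nx1 (m a)
    have c2 := h.nx1 (m b)
    have c3 := h.ny1 (m a)
    have c4 := h.ny1 (m b)
    refine ⟨?_, ?_, ?_, ?_⟩ <;> rintro rfl <;> grind
  have x1S := h.x1S
  have x2S := h.x2S
  have y1S := h.y1S
  have y2S := h.y2S
  have huv := h.huv
  have h11 := h.h11
  have nv := h.nv
  have nu := h.nu
  have hca : ∀ t, G.Adj t a → t ∉ S → t = x1 ∨ t = x2 := by
    intro t ht htS
    have := h.base.out aS x1S x2S h.hx X1.symm X3.symm ht.symm
    grind
  have hcb : ∀ t, G.Adj t b → t ∉ S → t = x1 ∨ t = x2 := by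
    intro t ht htS
    have := h.base.out bS x1S x2S h.hx X2.symm X4.symm ht.symm
    grind
  have hcd' : ∀ t, G.Adj t d → t ∉ S → t = y1 ∨ t = y2 := by
    intro t ht htS
    have := h.base.out dS y1S y2S h.hy Y2.symm Y4.symm ht.symm
    grind
  have hcmc : ∀ t, G.Adj t (m c) → t ∉ S → t = z1 ∨ t = z3 := by
    intro t ht htS
    have := h.base.out mcS z1S z3S d13 j1.symm j3.symm ht.symm
    grind
  have hcmd : ∀ t, G.Adj t (m d) → t ∉ S → t = z2 ∨ t = z4 := by
    intro t ht htS
    have := h.base.out mdS z2S z4S d24 j2.symm j4.symm ht.symm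
    grind
  have R10 : (({u, v} : Finset V) ∪ ({a, m a} ∪ {b, m b}) ∪ ({c, m c} ∪ {d, m d})).card = 10 := by
    rw [Finset.card_union_of_disjoint, card_pairs3 huv maa.symm mbb.symm, card_pairs2 mcc.symm mdd.symm]
    · grind
    · grind
    · grind
    · grind
    · rw [Finset.disjoint_left]; intro t; grind
  have Q8 : (({z1, m a} ∪ {z4, m b} : Finset V) ∪ ({u, x1} ∪ {y1, c})).card ≤ 8 := by
    have := Finset.card_union_le ({z1, m a} ∪ {z4, m b} : Finset V) ({u, x1} ∪ {y1, c})
    have := card_pairs2_le z1 (m a) z4 (m b)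
    have := card_pairs2_le u x1 y1 c
    omega
  refine h.base.kill (({u, v} : Finset V) ∪ ({a, m a} ∪ {b, m b}) ∪ ({c, m c} ∪ {d, m d}))
    (({z1, m a} ∪ {z4, m b}) ∪ ({u, x1} ∪ {y1, c})) ?_ ?_ ?_ ?_ ?_ ?_
  · intro t ht
    simp only [Finset.mem_union, Finset.mem_insert, Finset.mem_singleton] at ht
    rcases ht with ((rfl | rfl) | (rfl | rfl) | (rfl | rfl)) | ((rfl | rfl) | (rfl | rfl)) <;>
      assumption
  · intro t ht
    simp only [Finset.mem_union, Finset.mem_insert, Finset.mem_singleton] at ht ⊢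
    clear k1 k2 k3 k4 hca hcb hcd' hcmc hcmd nu nv
    grind
  · refine ((HasM.pair i1).union (HasM.pair i4) ?_).union
      ((HasM.pair U1).union (HasM.pair Y1) ?_) ?_
    · intro t; grind
    · intro t; grind
    · intro t; grind
  · intro t ht htS
    simp only [Finset.mem_union, Finset.mem_insert, Finset.mem_singleton] at ht ⊢
    clear k1 k2 k3 k4 hca hcb hcd' hcmc hcmd nu nv
    grind
  · omega
  · intro t ht htQ
    by_cases htS : t ∈ S
    · have : t = v ∨ t = a ∨ t = b ∨ t = m c ∨ t = d ∨ t = m d := by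
        have := ht htS
        grind
      rcases this with rfl | rfl | rfl | rfl | rfl | rfl
      · exact ⟨u, by simp, UV.symm⟩
      · exact ⟨m t, by simp, aa⟩
      · exact ⟨m t, by simp, ab⟩
      · exact ⟨c, by simp, ac.symm⟩
      · exact ⟨y1, by simp, Y2.symm⟩
      · exact ⟨z4, by simp, j4.symm⟩
    · obtain ⟨s, hs, hts⟩ := h.base.dom t htS
      by_cases hsT : (s ∈ S ∧ s ∉ (({u, v} : Finset V) ∪ ({a, m a} ∪ {b, m b}) ∪
          ({c, m c} ∪ {d, m d}))) ∨
          s ∈ (({z1, m a} ∪ {z4, m b} : Finset V) ∪ ({u, x1} ∪ {y1, c}))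
      · exact ⟨s, hsT, hts⟩
      · have hs2 : s = v ∨ s = a ∨ s = b ∨ s = m c ∨ s = d ∨ s = m d := by grind
        have : t = x1 ∨ t = x2 ∨ t = y1 ∨ t = y2 ∨ t = z1 ∨ t = z2 ∨ t = z3 ∨ t = z4 := by
          rcases hs2 with rfl | rfl | rfl | rfl | rfl | rfl
          · have := (h.nv t).1 hts.symm; grind
          · have := hca t hts; grind
          · have := hcb t hts; grind
          · have := hcmc t hts; grind
          · have := hcd' t hts; grind
          · have := hcmd t hts; grind
        rcases this with rfl | rfl | rfl | rfl | rfl | rfl | rfl | rfl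
        · exact ⟨u, by simp, U1.symm⟩
        · exact ⟨u, by simp, U2.symm⟩
        · exact ⟨c, by simp, Y1⟩
        · exact ⟨c, by simp, Y3⟩
        · exact ⟨m a, by simp, i1⟩
        · exact ⟨m a, by simp, i2⟩
        · exact ⟨m b, by simp, i3⟩
        · exact ⟨m b, by simp, i4⟩

/-- Either `Y` has four distinct elements or (up to swaps) it has exactly two. -/
theorem Cfg.Ydist (h : Cfg G S m D u v x1 x2 y1 y2 a1 a2 b1 b2 c1 c2 d1 d2) :
    (c1 ≠ d1 ∧ c1 ≠ d2 ∧ c2 ≠ d1 ∧ c2 ≠ d2) ∨ (c1 = d1 ∧ c2 = d2) ∨ (c1 = d2 ∧ c2 = d1) := by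
  by_contra hcon
  have : (c1 = d1 ∧ c2 ≠ d2) ∨ (c1 = d2 ∧ c2 ≠ d1) ∨ (c2 = d1 ∧ c1 ≠ d2) ∨
      (c2 = d2 ∧ c1 ≠ d1) := by grind
  rcases this with ⟨rfl, e⟩ | ⟨rfl, e⟩ | ⟨rfl, e⟩ | ⟨rfl, e⟩
  · exact h.Y3 e
  · exact h.swapD.Y3 e
  · exact h.swapC.Y3 e
  · exact h.swapC.swapD.Y3 e

/-- `X` or `Y` has four elements. -/
theorem Cfg.dist (h : Cfg G S m D u v x1 x2 y1 y2 a1 a2 b1 b2 c1 c2 d1 d2) :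
    (c1 ≠ d1 ∧ c1 ≠ d2 ∧ c2 ≠ d1 ∧ c2 ≠ d2) ∨ (a1 ≠ b1 ∧ a1 ≠ b2 ∧ a2 ≠ b1 ∧ a2 ≠ b2) := by
  by_contra hcon
  push Not at hcon
  have h1 := h.Ydist
  have h2 := h.swapU.Ydist
  have h1' : (c1 = d1 ∧ c2 = d2) ∨ (c1 = d2 ∧ c2 = d1) := by grind
  have h2' : (a1 = b1 ∧ a2 = b2) ∨ (a1 = b2 ∧ a2 = b1) := by grind
  rcases h1' with ⟨rfl, rfl⟩ | ⟨rfl, rfl⟩ <;> rcases h2' with ⟨rfl, rfl⟩ | ⟨rfl, rfl⟩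
  · exact h.kill22
  · exact h.swapB.kill22
  · exact h.swapD.kill22
  · exact h.swapB.swapD.kill22

/-- If `Y` has four elements then `X = Y` and it is closed under `m`. -/
theorem Cfg.XY (h : Cfg G S m D u v x1 x2 y1 y2 a1 a2 b1 b2 c1 c2 d1 d2)
    (hd : c1 ≠ d1 ∧ c1 ≠ d2 ∧ c2 ≠ d1 ∧ c2 ≠ d2) {w : V}
    (hw : w = a1 ∨ w = a2 ∨ w = b1 ∨ w = b2) :
    (w = c1 ∨ w = c2 ∨ w = d1 ∨ w = d2) ∧ (m w = c1 ∨ m w = c2 ∨ m w = d1 ∨ m w = d2) := by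
  obtain ⟨e1, e2, e3, e4⟩ := hd
  have := h.hc
  have := h.hd
  have l1 := h.L3 hw (p := c1) (q := c2) (r := d1) (by simp) (by simp) (by simp) (by grind) e1 e3
  have l2 := h.L3 hw (p := c1) (q := c2) (r := d2) (by simp) (by simp) (by simp) (by grind) e2 e4
  have l3 := h.L3 hw (p := c1) (q := d1) (r := d2) (by simp) (by simp) (by simp) e1 e2 (by grind)
  have l4 := h.L3 hw (p := c2) (q := d1) (r := d2) (by simp) (by simp) (by simp) e3 e4 (by grind)
  grind

theorem Cfg.Xdist (h : Cfg G S m D u v x1 x2 y1 y2 a1 a2 b1 b2 c1 c2 d1 d2)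
    (hd : c1 ≠ d1 ∧ c1 ≠ d2 ∧ c2 ≠ d1 ∧ c2 ≠ d2) :
    (a1 ≠ b1 ∧ a1 ≠ b2 ∧ a2 ≠ b1 ∧ a2 ≠ b2) := by
  have key : ∀ w, (w = a1 ∨ w = a2) → (w = b1 ∨ w = b2) → False := by
    intro w h1 h2
    have wS := h.base.DS _ (h.nn w (by grind)).1
    have X1 : G.Adj w x1 := ((h.nx1 _).2 (by grind)).symm
    have X2 : G.Adj w x2 := ((h.nx2 _).2 (by grind)).symm
    have hY : G.Adj w y1 ∨ G.Adj w y2 := by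
      rcases (h.XY hd (w := w) (by grind)).1 with e | e | e | e
      · left; exact ((h.ny1 _).2 (by grind)).symm
      · left; exact ((h.ny1 _).2 (by grind)).symm
      · right; exact ((h.ny2 _).2 (by grind)).symm
      · right; exact ((h.ny2 _).2 (by grind)).symm
    have := (h.base.mt _ wS).1
    have := h.h11
    have := h.h12
    have := h.h21
    have := h.h22
    have := h.y1S
    have := h.y2S
    rcases hY with Y | Y
    · have := h.base.out wS h.x1S h.x2S h.hx X1 X2 Y; grind
    · have := h.base.out wS h.x1S h.x2S h.hx X1 X2 Y; grind
  refine ⟨?_, ?_, ?_, ?_⟩ <;> intro e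
  · exact key a1 (by simp) (by grind)
  · exact key a1 (by simp) (by grind)
  · exact key a2 (by simp) (by grind)
  · exact key a2 (by simp) (by grind)

theorem Cfg.na12 (h : Cfg G S m D u v x1 x2 y1 y2 a1 a2 b1 b2 c1 c2 d1 d2)
    (hd : c1 ≠ d1 ∧ c1 ≠ d2 ∧ c2 ≠ d1 ∧ c2 ≠ d2) : m a1 ≠ a2 := by
  intro e
  have hX := h.Xdist hd
  have q1 := h.XY hd (w := a1) (by simp)
  have q2 := h.XY hd (w := a2) (by simp)
  have q3 := h.XY hd (w := b1) (by simp)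
  have q4 := h.XY hd (w := b2) (by simp)
  have r1 := h.nn a1 (by simp)
  have r2 := h.nn b1 (by simp)
  have r3 := h.nn b2 (by simp)
  have r4 := h.nn a2 (by simp)
  have s1 := h.base.DS _ r1.1
  have s2 := h.base.DS _ r2.1
  have s3 := h.base.DS _ r3.1
  have M1 := h.base.mt _ s1
  have M2 := h.base.mt _ s2
  have M3 := h.base.mt _ s3
  have ha := h.ha
  have hb := h.hb
  have hc := h.hc
  have hd' := h.hd
  have hbb : m b1 = b2 := by grind
  obtain ⟨z, zS, i, j, k⟩ := h.K (w := a2) (w' := b1) (by simp) (by grind) (by grind) (by grind)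
  obtain ⟨z', zS', i', j', k'⟩ := h.K (w := a2) (w' := b2) (by simp) (by grind) (by grind) (by grind)
  have t1 : m a2 = a1 := by grind
  have t2 : m b2 = b1 := by grind
  rw [t1] at i i' k k'
  rw [hbb] at j k
  rw [t2] at j' k'
  have hzz : z ≠ z' := by
    rintro rfl
    have := k _ s2 j'
    grind
  have X1 : G.Adj a1 x1 := ((h.nx1 _).2 (by simp)).symm
  have := h.base.out s1 zS zS' hzz i.symm i'.symm X1
  have x1S := h.x1S
  have nx1 := h.nx1
  have : x1 = z ∨ x1 = z' := by grind
  rcases this with rfl | rfl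
  · have := (nx1 _).1 j; grind
  · have := (nx1 _).1 j'; grind

end

/-- Neighbour table of the Petersen graph. -/
def petN : Fin 10 → Fin 3 → Fin 10 :=
  ![![1, 2, 3], ![0, 4, 5], ![0, 6, 8], ![0, 7, 9], ![1, 6, 9], ![1, 7, 8],
    ![7, 2, 4], ![6, 3, 5], ![9, 2, 5], ![8, 3, 4]]

/-- Labels of the vertices of the Petersen graph. -/
def petP : Fin 10 → {s : Finset (Fin 5) // s.card = 2} :=
  ![⟨{0, 1}, by decide⟩, ⟨{2, 3}, by decide⟩, ⟨{2, 4}, by decide⟩, ⟨{3, 4}, by decide⟩,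
    ⟨{0, 4}, by decide⟩, ⟨{1, 4}, by decide⟩, ⟨{1, 3}, by decide⟩, ⟨{0, 2}, by decide⟩,
    ⟨{0, 3}, by decide⟩, ⟨{1, 2}, by decide⟩]

theorem petP_inj : Function.Injective petP := by
  intro i j
  revert i j
  decide

theorem petP_bij : Function.Bijective petP := by
  rw [Fintype.bijective_iff_injective_and_card]
  refine ⟨petP_inj, ?_⟩
  simp only [Fintype.card_fin, Fintype.card_finset_len]
  rfl

theorem petP_adj : ∀ i j, petersenGraph.Adj (petP i) (petP j) ↔ ∃ k, j = petN i k := by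
  have : ∀ i j, Disjoint (petP i : Finset (Fin 5)) (petP j : Finset (Fin 5)) ↔
    ∃ k, j = petN i k := by decide
  exact this

theorem iso_of_table {V : Type*} {G : SimpleGraph V} (hconn : G.Connected) (F : Fin 10 → V)
    (hF : Function.Injective F) (hN : ∀ i t, G.Adj (F i) t ↔ ∃ k, t = F (petN i k)) :
    Nonempty (G ≃g petersenGraph) := by
  have hsurj : Function.Surjective F := by
    have key : ∀ s t, G.Walk s t → (∃ i, F i = s) → ∃ i, F i = t := by
      intro s t w
      induction w with
      | nil => exact id
      | cons hadj _ ih =>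
        rintro ⟨i, rfl⟩
        obtain ⟨k, hk⟩ := (hN i _).1 hadj
        exact ih ⟨_, hk.symm⟩
    intro t
    obtain ⟨w⟩ := hconn.preconnected (F 0) t
    exact key _ _ w ⟨0, rfl⟩
  let e1 := Equiv.ofBijective F ⟨hF, hsurj⟩
  let e2 := Equiv.ofBijective petP petP_bij
  have hadj : ∀ i j, G.Adj (F i) (F j) ↔ petersenGraph.Adj (petP i) (petP j) := by
    intro i j
    rw [petP_adj, hN]
    simp only [hF.eq_iff]
  refine ⟨⟨e1.symm.trans e2, ?_⟩⟩
  intro s t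
  obtain ⟨i, rfl⟩ := e1.surjective s
  obtain ⟨j, rfl⟩ := e1.surjective t
  simp only [Equiv.trans_apply, Equiv.symm_apply_apply]
  exact (hadj i j).symm

section
variable {V : Type*} [DecidableEq V] {G : SimpleGraph V}
    {S : Finset V} {m : V → V} {D : V → Prop}
    {u v x1 x2 y1 y2 a1 a2 b1 b2 c1 c2 d1 d2 : V}

theorem Cfg.pet {p q : V} (hconn : G.Connected)
    (h : Cfg G S m D u v x1 x2 y1 y2 p q (m p) (m q) p (m q) (m p) q) :
    Nonempty (G ≃g petersenGraph) := by
  have np := h.nn p (by simp)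
  have nq := h.nn q (by simp)
  have nmp := h.nn (m p) (by simp)
  have nmq := h.nn (m q) (by simp)
  have pS := h.base.DS _ np.1
  have qS := h.base.DS _ nq.1
  have uS := h.base.DS _ h.Du
  have vS := h.base.DS _ h.Dv
  obtain ⟨mpS, mpp, ap, mmp⟩ := h.base.mt _ pS
  obtain ⟨mqS, mqq, aq, mmq⟩ := h.base.mt _ qS
  have x1S := h.x1S
  have x2S := h.x2S
  have y1S := h.y1S
  have y2S := h.y2S
  have nbr : ∀ {w a b}, w ∈ S → a ∉ S → b ∉ S → a ≠ b → G.Adj a w → G.Adj b w →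
      ∀ t, G.Adj w t ↔ t = m w ∨ t = a ∨ t = b := by
    intro w a b hw ha hb hab h1 h2 t
    constructor
    · intro h3
      exact h.base.out hw ha hb hab h1.symm h2.symm h3
    · rintro (rfl | rfl | rfl)
      · exact (h.base.mt _ hw).2.2.1
      · exact h1.symm
      · exact h2.symm
  have n6 := nbr pS x1S y1S h.h11 ((h.nx1 _).2 (by simp)) ((h.ny1 _).2 (by simp))
  have n7 := nbr mpS x2S y2S h.h22 ((h.nx2 _).2 (by simp)) ((h.ny2 _).2 (by simp))
  have n8 := nbr qS x1S y2S h.h12 ((h.nx1 _).2 (by simp)) ((h.ny2 _).2 (by simp))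
  have n9 := nbr mqS x2S y1S h.h21 ((h.nx2 _).2 (by simp)) ((h.ny1 _).2 (by simp))
  rw [mmp] at n7
  rw [mmq] at n9
  refine iso_of_table hconn ![u, v, x1, x2, y1, y2, p, m p, q, m q] ?_ ?_
  · have e1 := h.huv
    have e2 := h.hx
    have e3 := h.hy
    have e4 := h.h11
    have e5 := h.h12
    have e6 := h.h21
    have e7 := h.h22
    have e8 := h.ha
    have e9 := h.hb
    have e10 := h.hc
    have e11 := h.hd
    have key : [u, v, x1, x2, y1, y2, p, m p, q, m q].Nodup := by
      simp only [List.nodup_cons, List.mem_cons, List.not_mem_nil, or_false, not_or,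
        List.nodup_nil, and_true, not_false_eq_true]
      have sne : ∀ s ∈ S, ∀ t, t ∉ S → s ≠ t ∧ t ≠ s := by grind
      clear n6 n7 n8 n9 nbr
      and_intros <;> grind
    have := List.nodup_iff_injective_get.1 key
    intro i j hij
    apply this
    fin_cases i <;> fin_cases j <;> first | rfl | exact hij
  · intro i t
    rw [Fin.exists_fin_succ, Fin.exists_fin_two]
    fin_cases i
    · exact h.nu t
    · exact h.nv t
    · exact h.nx1 t
    · exact h.nx2 t
    · exact (h.ny1 t)
    · exact (h.ny2 t)
    · exact n6 t
    · exact n7 t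
    · exact n8 t
    · exact n9 t

theorem Cfg.P4c {p q : V} (hconn : G.Connected)
    (h : Cfg G S m D u v x1 x2 y1 y2 p q (m p) (m q) p c2 d1 d2)
    (hd : p ≠ d1 ∧ p ≠ d2 ∧ c2 ≠ d1 ∧ c2 ≠ d2) : Nonempty (G ≃g petersenGraph) := by
  have hX := h.Xdist hd
  have np := h.nn p (by simp)
  have nq := h.nn q (by simp)
  have nmp := h.nn (m p) (by simp)
  have nmq := h.nn (m q) (by simp)
  have pS := h.base.DS _ np.1
  have qS := h.base.DS _ nq.1
  obtain ⟨mpS, mpp, ap, mmp⟩ := h.base.mt _ pS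
  obtain ⟨mqS, mqq, aq, mmq⟩ := h.base.mt _ qS
  have hn : m p ≠ c2 := h.swapU.na12 hX
  have x1S := h.x1S
  have y1S := h.y1S
  have ha := h.ha
  have hb := h.hb
  have hc := h.hc
  have hd' := h.hd
  have q1 := h.swapU.XY hX (w := c2) (by simp)
  have q2 := h.swapU.XY hX (w := d1) (by simp)
  have q3 := h.swapU.XY hX (w := d2) (by simp)
  have c2q : c2 ≠ q := by
    rintro rfl
    obtain ⟨z, zS, i, j, k⟩ := h.K (w := m p) (w' := c2) (by simp) (by simp) hn (by grind)
    rw [mmp] at i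
    have := h.base.out pS x1S y1S h.h11 ((h.nx1 _).2 (by simp)).symm
      ((h.ny1 _).2 (by simp)).symm i.symm
    have : z = x1 ∨ z = y1 := by grind
    rcases this with rfl | rfl
    · have := (h.nx1 _).1 j; grind
    · have := (h.ny1 _).1 j; grind
  have hc2 : c2 = m q := by grind
  subst hc2
  have : (d1 = m p ∧ d2 = q) ∨ (d2 = m p ∧ d1 = q) := by grind
  rcases this with ⟨rfl, rfl⟩ | ⟨rfl, rfl⟩
  · exact h.pet hconn
  · exact h.swapD.pet hconn

theorem Cfg.P4b {p q : V} (hconn : G.Connected)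
    (h : Cfg G S m D u v x1 x2 y1 y2 p q (m p) (m q) c1 c2 d1 d2)
    (hd : c1 ≠ d1 ∧ c1 ≠ d2 ∧ c2 ≠ d1 ∧ c2 ≠ d2) : Nonempty (G ≃g petersenGraph) := by
  have q1 := (h.XY hd (w := p) (by simp)).1
  rcases q1 with rfl | rfl | rfl | rfl
  · exact h.P4c hconn hd
  · exact h.swapC.P4c hconn (by grind)
  · exact h.swapY.P4c hconn (by grind)
  · exact h.swapY.swapC.P4c hconn (by grind)

theorem Cfg.P4 (hconn : G.Connected)
    (h : Cfg G S m D u v x1 x2 y1 y2 a1 a2 b1 b2 c1 c2 d1 d2)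
    (hd : c1 ≠ d1 ∧ c1 ≠ d2 ∧ c2 ≠ d1 ∧ c2 ≠ d2) : Nonempty (G ≃g petersenGraph) := by
  have hX := h.Xdist hd
  have hn := h.na12 hd
  have q1 := h.XY hd (w := a1) (by simp)
  have q2 := h.XY hd (w := a2) (by simp)
  have q3 := h.XY hd (w := b1) (by simp)
  have q4 := h.XY hd (w := b2) (by simp)
  have M1 := h.base.mt _ (h.base.DS _ (h.nn a1 (by simp)).1)
  have M2 := h.base.mt _ (h.base.DS _ (h.nn a2 (by simp)).1)
  have ha := h.ha
  have hb := h.hb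
  have hc := h.hc
  have hd' := h.hd
  have back : ∀ w, (w = c1 ∨ w = c2 ∨ w = d1 ∨ w = d2) → w = a1 ∨ w = a2 ∨ w = b1 ∨ w = b2 :=
    fun w hw => (h.swapU.XY hX hw).1
  have r1 : m a1 = b1 ∨ m a1 = b2 := by
    have := back _ q1.2
    clear q1 q2 q3 q4
    grind
  have r2 : m a2 = b1 ∨ m a2 = b2 := by
    have := back _ q2.2
    clear q1 q2 q3 q4
    grind
  have : (b1 = m a1 ∧ b2 = m a2) ∨ (b2 = m a1 ∧ b1 = m a2) := by
    clear q1 q2 q3 q4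
    grind
  rcases this with ⟨rfl, rfl⟩ | ⟨rfl, rfl⟩
  · exact h.P4b hconn hd
  · exact h.swapB.P4b hconn hd

theorem Cfg.main (hconn : G.Connected)
    (h : Cfg G S m D u v x1 x2 y1 y2 a1 a2 b1 b2 c1 c2 d1 d2) :
    Nonempty (G ≃g petersenGraph) := by
  rcases h.dist with hd | hd
  · exact h.P4 hconn hd
  · exact h.swapU.P4 hconn hd

end
theorem solo_D_pair_four_thirds_petersen {V : Type*} [Fintype V] [DecidableEq V]
    (G : SimpleGraph V) [DecidableRel G.Adj] (S : Finset V) (m : V → V)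
    (hconn : G.Connected)
    (hcubic : ∀ v : V, G.degree v = 3)
    (hdom : ∀ v : V, v ∉ S → ∃ u ∈ S, G.Adj v u)
    (hmatch : IsMatchingOn G S m)
    (hmincard : ∀ T : Finset V, IsPDS G T → S.card ≤ T.card)
    (hP1 : ∀ T : Finset V, IsPDS G T → T.card = S.card → lambdaS G S ≤ lambdaS G T)
    (hP2 : ∀ (T : Finset V) (m' : V → V),
        (∀ v : V, v ∉ T → ∃ u ∈ T, G.Adj v u) → IsMatchingOn G T m' →
        T.card = S.card → lambdaS G T = lambdaS G S →
        (setA G S m ∪ setB G S m).card ≤ (setA G T m' ∪ setB G T m').card) :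
    ∀ u : V, u ∈ setD G S m → IsSoloPair G S m u →
      (¬ ∃ x : V, x ∉ S ∧ G.Adj u x ∧ G.Adj (m u) x) →
      (∀ x : V, x ∉ S → G.Adj x u → fwt G S m x u = 1/3) →
      (∀ x : V, x ∉ S → G.Adj x (m u) → fwt G S m x (m u) = 1/3) →
      Nonempty (G ≃g petersenGraph) := by
  intro u hu hsolo hcom hwu hwv
  have nb3 : ∀ t, (G.neighborFinset t).card = 3 := by
    intro t; rw [G.card_neighborFinset_eq_degree]; exact hcubic t
  have hbase : Base G S m (fun t => t ∈ setD G S m) := by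
    refine ⟨hmatch, hdom, hmincard, ?_, ?_, ?_, ?_⟩
    · intro t p q r s hp hq hr hs
      by_contra hcon
      push Not at hcon
      have hsub : ({p, q, r, s} : Finset V) ⊆ G.neighborFinset t := by
        intro a
        simp only [Finset.mem_insert, Finset.mem_singleton, SimpleGraph.mem_neighborFinset]
        rintro (rfl | rfl | rfl | rfl) <;> assumption
      have h1 := Finset.card_le_card hsub
      rw [nb3, Finset.card_insert_of_notMem, Finset.card_insert_of_notMem,
        Finset.card_pair] at h1
      · omega
      all_goals grind
    · intro t ht
      exact (Finset.mem_filter.1 ht).1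
    · intro t ht
      have h1 := Finset.mem_filter.1 ht
      have h2 := hmatch t h1.1
      refine Finset.mem_filter.2 ⟨h2.1, h1.2.2, ?_⟩
      rw [h2.2.2.2]
      exact h1.2.1
    · intro t z ht hz hzt
      have h1 := Finset.mem_filter.1 ht
      by_contra hcon
      push Not at hcon
      have h2 : z ∈ privates G S t := by
        refine Finset.mem_filter.2 ⟨Finset.mem_univ _, hz, ?_⟩
        ext a
        simp only [nbrS, Finset.mem_filter, Finset.mem_singleton]
        constructor
        · rintro ⟨h3, h4⟩
          by_contra h5
          exact hcon a h3 h5 h4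
        · rintro rfl
          exact ⟨h1.1, hzt⟩
      rw [h1.2.1] at h2
      simp at h2
  have hv := hbase.Dm u hu
  have uS := hbase.DS u hu
  obtain ⟨vS, hne, huv, mmu⟩ := hmatch u uS
  have out : ∀ t ∈ S, IsLeaf G S t → ∃ p q, p ≠ q ∧ p ∉ S ∧ q ∉ S ∧
      ∀ s, G.Adj t s ↔ s = m t ∨ s = p ∨ s = q := by
    intro t ht hl
    obtain ⟨g1, g2, g3, g4⟩ := hmatch t ht
    have c1 : ((G.neighborFinset t).erase (m t)).card = 2 := by
      rw [Finset.card_erase_of_mem (by simpa using g3), nb3]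
    obtain ⟨p, q, hpq, e⟩ := Finset.card_eq_two.1 c1
    obtain ⟨r, hr⟩ := Finset.card_eq_one.1 hl
    have hmr : m t = r := by
      have : m t ∈ nbrS G S t := Finset.mem_filter.2 ⟨g1, g3⟩
      rw [hr] at this
      simpa using this
    have e' : ∀ s, (s ≠ m t ∧ G.Adj t s) ↔ s = p ∨ s = q := by
      intro s
      have : s ∈ (G.neighborFinset t).erase (m t) ↔ s ∈ ({p, q} : Finset V) := by rw [e]
      simpa using this
    have o : ∀ s, s ≠ m t → G.Adj t s → s ∉ S := by
      intro s h1 h2 h3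
      have : s ∈ nbrS G S t := Finset.mem_filter.2 ⟨h3, h2⟩
      rw [hr, ← hmr] at this
      exact h1 (by simpa using this)
    have hp := (e' p).2 (by simp)
    have hq := (e' q).2 (by simp)
    refine ⟨p, q, hpq, o p hp.1 hp.2, o q hq.1 hq.2, ?_⟩
    intro s
    have := e' s
    grind
  have wt : ∀ t ∈ setD G S m, ∀ x, x ∉ S → G.Adj x t → fwt G S m x t = 1/3 →
      ∃ a b, a ≠ b ∧ (a ∈ setD G S m ∧ a ≠ t) ∧ (b ∈ setD G S m ∧ b ≠ t) ∧
        ∀ s, G.Adj x s ↔ s = t ∨ s = a ∨ s = b := by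
    intro t ht x hx hxt hf
    have ht' := Finset.mem_filter.1 ht
    have tS := ht'.1
    have tn : t ∈ nbrS G S x := Finset.mem_filter.2 ⟨tS, hxt⟩
    have tA : t ∉ setA G S m := by
      intro h
      have := (Finset.mem_filter.1 h).2
      rw [ht'.2.1, ht'.2.2] at this
      simp at this
    have BCD : ∀ s, s ∈ setB G S m ∪ setC G S m → s ∉ setD G S m := by
      intro s hs hs'
      have hD := Finset.mem_filter.1 hs'
      rcases Finset.mem_union.1 hs with h | h
      · have := (Finset.mem_filter.1 h).2.1
        rw [hD.2.1] at this
        simp at this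
      · have h2 := (Finset.mem_filter.1 h).2
        have := (Finset.mem_filter.1 h2).2.1
        rw [hD.2.2] at this
        simp at this
    have hsubN : nbrS G S x ⊆ G.neighborFinset x := by
      intro s hs
      simpa using (Finset.mem_filter.1 hs).2
    have hle : (nbrS G S x).card ≤ 3 := by
      rw [← nb3 x]; exact Finset.card_le_card hsubN
    have hres : (nbrS G S x).card = 3 ∧ nbrS G S x ⊆ setD G S m := by
      unfold fwt at hf
      rw [if_neg (by simp [hx, tS, hxt]), if_neg tA] at hf
      split_ifs at hf with i1 i2 i4 i5
      · norm_num at hf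
      · rcases i2 with i2 | i2 | i2
        · exact absurd (i2 tn) tA
        · exact absurd ht (BCD _ (i2 tn))
        · refine ⟨?_, i2⟩
          generalize (nbrS G S x).card = n at hf hle
          interval_cases n <;> first | rfl | norm_num at hf
      · exact absurd (i4 ▸ Finset.mem_inter.2 ⟨tn, ht⟩) (Finset.notMem_empty _)
      · exact absurd ht (BCD _ i5)
      · exfalso
        have hdis : Disjoint (nbrS G S x ∩ (setB G S m ∪ setC G S m))
            (nbrS G S x ∩ setD G S m) := by
          rw [Finset.disjoint_left]
          intro s h1 h2
          exact BCD s (Finset.mem_inter.1 h1).2 (Finset.mem_inter.1 h2).2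
        have hc := Finset.card_union_of_disjoint hdis
        have hsub : (nbrS G S x ∩ (setB G S m ∪ setC G S m)) ∪ (nbrS G S x ∩ setD G S m) ⊆
            nbrS G S x := by
          intro s hs
          rcases Finset.mem_union.1 hs with h | h
          · exact (Finset.mem_inter.1 h).1
          · exact (Finset.mem_inter.1 h).1
        have hc2 := Finset.card_le_card hsub
        have hd3 : (nbrS G S x ∩ setD G S m).card ≠ 3 := by
          intro h3
          apply i2
          right; right
          have := Finset.eq_of_subset_of_card_le
            (Finset.inter_subset_left (s₁ := nbrS G S x) (s₂ := setD G S m)) (by omega)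
          rw [← this]
          exact Finset.inter_subset_right
        rw [hc] at hc2
        generalize (nbrS G S x ∩ (setB G S m ∪ setC G S m)).card = b at hf hc2
        generalize (nbrS G S x ∩ setD G S m).card = d at hf hc2 hd3
        have hb3 : b ≤ 3 := by omega
        have hd2 : d ≤ 2 := by omega
        interval_cases d <;> interval_cases b <;> first | omega | norm_num at hf
    obtain ⟨h3, hD⟩ := hres
    have hEq : nbrS G S x = G.neighborFinset x :=
      Finset.eq_of_subset_of_card_le hsubN (by rw [nb3, h3])
    have c1 : ((nbrS G S x).erase t).card = 2 := by
      rw [Finset.card_erase_of_mem tn, h3]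
    obtain ⟨p, q, hpq, e⟩ := Finset.card_eq_two.1 c1
    have e' : ∀ s, (s ≠ t ∧ s ∈ nbrS G S x) ↔ s = p ∨ s = q := by
      intro s
      have : s ∈ (nbrS G S x).erase t ↔ s ∈ ({p, q} : Finset V) := by rw [e]
      simpa using this
    have hp := (e' p).2 (by simp)
    have hq := (e' q).2 (by simp)
    refine ⟨p, q, hpq, ⟨hD hp.2, hp.1⟩, ⟨hD hq.2, hq.1⟩, ?_⟩
    intro s
    have e2 := e' s
    rw [hEq, SimpleGraph.mem_neighborFinset] at e2
    constructor
    · intro hs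
      by_cases hst : s = t
      · exact Or.inl hst
      · exact Or.inr (e2.1 ⟨hst, hs⟩)
    · rintro (rfl | hs)
      · exact hxt
      · exact (e2.2 hs).2
  obtain ⟨x1, x2, hx, x1S, x2S, nu⟩ := out u uS hsolo.1
  obtain ⟨y1, y2, hy, y1S, y2S, nv⟩ := out (m u) vS hsolo.2
  rw [mmu] at nv
  have ux1 : G.Adj x1 u := ((nu _).2 (by simp)).symm
  have ux2 : G.Adj x2 u := ((nu _).2 (by simp)).symm
  have vy1 : G.Adj y1 (m u) := ((nv _).2 (by simp)).symm
  have vy2 : G.Adj y2 (m u) := ((nv _).2 (by simp)).symm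
  have com : ∀ x, x ∉ S → G.Adj x u → G.Adj x (m u) → False :=
    fun x h1 h2 h3 => hcom ⟨x, h1, h2.symm, h3.symm⟩
  obtain ⟨a1, a2, ha, da1, da2, nx1⟩ := wt u hu x1 x1S ux1 (hwu _ x1S ux1)
  obtain ⟨b1, b2, hb, db1, db2, nx2⟩ := wt u hu x2 x2S ux2 (hwu _ x2S ux2)
  obtain ⟨c1, c2, hc, dc1, dc2, ny1⟩ := wt (m u) hv y1 y1S vy1 (hwv _ y1S vy1)
  obtain ⟨d1, d2, hd, dd1, dd2, ny2⟩ := wt (m u) hv y2 y2S vy2 (hwv _ y2S vy2)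
  have X1 : ∀ w, G.Adj x1 w → w ≠ m u := fun w h1 h2 => com x1 x1S ux1 (h2 ▸ h1)
  have X2 : ∀ w, G.Adj x2 w → w ≠ m u := fun w h1 h2 => com x2 x2S ux2 (h2 ▸ h1)
  have Y1 : ∀ w, G.Adj y1 w → w ≠ u := fun w h1 h2 => com y1 y1S (h2 ▸ h1) vy1
  have Y2 : ∀ w, G.Adj y2 w → w ≠ u := fun w h1 h2 => com y2 y2S (h2 ▸ h1) vy2
  have hcfg : Cfg G S m (fun t => t ∈ setD G S m) u (m u) x1 x2 y1 y2 a1 a2 b1 b2 c1 c2 d1 d2 := by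
    refine ⟨hbase, hu, hv, rfl, mmu, hne.symm, x1S, x2S, y1S, y2S, hx, hy, ?_, ?_, ?_, ?_,
      nu, nv, nx1, nx2, ny1, ny2, ha, hb, hc, hd, ?_⟩
    · rintro rfl; exact com _ x1S ux1 vy1
    · rintro rfl; exact com _ x1S ux1 vy2
    · rintro rfl; exact com _ x2S ux2 vy1
    · rintro rfl; exact com _ x2S ux2 vy2
    · rintro w (rfl | rfl | rfl | rfl | rfl | rfl | rfl | rfl)
      · exact ⟨da1.1, da1.2, X1 _ ((nx1 _).2 (by simp))⟩
      · exact ⟨da2.1, da2.2, X1 _ ((nx1 _).2 (by simp))⟩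
      · exact ⟨db1.1, db1.2, X2 _ ((nx2 _).2 (by simp))⟩
      · exact ⟨db2.1, db2.2, X2 _ ((nx2 _).2 (by simp))⟩
      · exact ⟨dc1.1, Y1 _ ((ny1 _).2 (by simp)), dc1.2⟩
      · exact ⟨dc2.1, Y1 _ ((ny1 _).2 (by simp)), dc2.2⟩
      · exact ⟨dd1.1, Y2 _ ((ny2 _).2 (by simp)), dd1.2⟩
      · exact ⟨dd2.1, Y2 _ ((ny2 _).2 (by simp)), dd2.2⟩
  exact hcfg.main hconn
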